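/- arXiv:2007.00553 — 6 statements merged into one kernel-verified Lean document; each statement's English description precedes it below -/
import Mathlib

section
/- Let n ≥ 3 and let f be the quadratic form f(x) = −x₀² + x₁² + ⋯ + x_n² on ℤ^{n+1}. For every sequence (r_k) of positive integers with r_k → ∞ as k → ∞, there exists a sequence (w_k) of vectors in ℤ^{n+1} such that: (i) f(w_k) = r_k for every k; (ii) (w_k)₁² > f(w_k) > 0 for every k, where (w_k)₁ denotes the coordinate of w_k of index 1; and (iii) the sequence of real numbers (w_k)₁² / f(w_k) tends to 1 as k → ∞. -/
open Filter

/-- The standard quadratic form of signature `(n,1)`: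
`f(x) = −x₀² + x₁² + ⋯ + x_n²` on `ℤ^{n+1}`. -/
def stdForm (n : ℕ) (w : Fin (n + 1) → ℤ) : ℤ :=
  -(w 0) ^ 2 + ∑ i ∈ Finset.Ioi (0 : Fin (n + 1)), (w i) ^ 2

/-- The form `x² + y² - z²` represents every integer. -/
theorem exists_sq_add_sq_sub_sq_eq (d : ℤ) : ∃ x y z : ℤ, x ^ 2 + y ^ 2 - z ^ 2 = d := by
  obtain ⟨e, rfl⟩ | ⟨e, rfl⟩ := d.even_or_odd
  · exact ⟨1, e, e - 1, by ring⟩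
  · exact ⟨0, e + 1, e, by ring⟩

/-- Every integer is a value of `stdForm n`, `n ≥ 3`, on vectors with prescribed coordinate `1`. -/
theorem exists_stdForm_eq {n : ℕ} (hn : 3 ≤ n) (a r : ℤ) :
    ∃ w : Fin (n + 1) → ℤ, stdForm n w = r ∧ w 1 = a := by
  obtain ⟨m, rfl⟩ := Nat.exists_eq_add_of_le' hn
  obtain ⟨x, y, z, h⟩ := exists_sq_add_sq_sub_sq_eq (r - a ^ 2)
  refine ⟨Fin.cons z (Fin.cons a (Fin.cons x (Fin.cons y fun _ => 0))), ?_, rfl⟩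
  rw [stdForm, Fin.sum_Ioi_zero]
  simp only [Fin.sum_univ_succ, Fin.cons_zero, Fin.cons_succ]
  simp
  linarith

/-- The squares of `⌊√x⌋ + 1` are asymptotic to `x`. -/
theorem tendsto_floor_sqrt_add_one_sq_div :
    Tendsto (fun x : ℝ => ((⌊√x⌋ + 1 : ℤ) : ℝ) ^ 2 / x) atTop (nhds 1) := by
  have hsq : Tendsto (fun x : ℝ => (1 + (√x)⁻¹) ^ 2) atTop (nhds 1) := by
    simpa using ((tendsto_inv_atTop_zero.comp Real.tendsto_sqrt_atTop).const_add 1).pow 2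
  refine tendsto_of_tendsto_of_tendsto_of_le_of_le' tendsto_const_nhds hsq ?_ ?_
  · filter_upwards [eventually_gt_atTop 0] with x hx
    rw [le_div_iff₀ hx, one_mul]
    push_cast
    exact (Real.sqrt_le_left (by positivity)).1 (Int.lt_floor_add_one _).le
  · filter_upwards [eventually_gt_atTop 0] with x hx
    have hs := Real.sqrt_pos.2 hx
    have h : (1 + (√x)⁻¹) ^ 2 = (√x + 1) ^ 2 / x := by
      nth_rewrite 3 [← Real.sq_sqrt hx.le]
      field_simp
    rw [h]
    push_cast
    gcongr
    exact Int.floor_le _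

/-- For `n ≥ 3` and every sequence of positive integers `r k → ∞` there is a
sequence of integer vectors `w k` with `f (w k) = r k`, `(w k 1)² > f (w k) > 0`
and `(w k 1)² / f (w k) → 1`. -/
theorem exists_vectors (n : ℕ) (hn : 3 ≤ n)
    (r : ℕ → ℤ) (hr : ∀ k, 0 < r k) (hr' : Tendsto r atTop atTop) :
    ∃ w : ℕ → (Fin (n + 1) → ℤ),
      (∀ k, stdForm n (w k) = r k) ∧
      (∀ k, 0 < stdForm n (w k) ∧ stdForm n (w k) < (w k 1) ^ 2) ∧
      Tendsto (fun k => ((w k 1 : ℝ)) ^ 2 / ((stdForm n (w k) : ℝ)))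
        atTop (nhds 1) := by
  choose w hw hw1 using fun k => exists_stdForm_eq hn (⌊√(r k : ℝ)⌋ + 1) (r k)
  refine ⟨w, hw, fun k => ⟨(hw k).symm ▸ hr k, ?_⟩, ?_⟩
  · rw [hw, hw1, ← Int.cast_lt (R := ℝ)]
    push_cast
    exact (Real.sqrt_lt' (by positivity)).1 (Int.lt_floor_add_one _)
  · simp only [hw, hw1]
    exact tendsto_floor_sqrt_add_one_sq_div.comp (tendsto_intCast_atTop_atTop.comp hr')
end

section
/- There exists a constant C > 0 such that for all sufficiently large k, |β_k² − √5·α_k² − (6 + √5)^k| ≤ C·β_k, where the absolute value is taken in the real numbers. (That is, the element ε_k = (6 + √5)^k + √5·α_k² − β_k² of ℤ[√5] satisfies ε_k = O(β_k) under the embedding of ℤ[√5] into ℝ sending √5 to the positive square root of 5.) -/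
open Filter

/-- `x_k = √((6 − √5)^k / √5)`. -/
noncomputable def xSeq (k : ℕ) : ℝ := Real.sqrt (((6 : ℝ) - Real.sqrt 5) ^ k / Real.sqrt 5)

/-- `α_k = ⌈x_k⌉ + √5`. -/
noncomputable def alphaSeq (k : ℕ) : ℝ := (⌈xSeq k⌉ : ℝ) + Real.sqrt 5

/-- `y_k = ⌊√(u_k / 10)⌋`, as a real number, where `u` is the sequence of first
components of `(6 + √5)^k` in `ℤ[√5]`. -/
noncomputable def ySeq (u : ℕ → ℤ) (k : ℕ) : ℝ := (⌊Real.sqrt ((u k : ℝ) / 10)⌋ : ℝ)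

/-- `β_k = ⌊√5 · y_k⌋ + √5 · y_k`. -/
noncomputable def betaSeq (u : ℕ → ℤ) (k : ℕ) : ℝ :=
  (⌊Real.sqrt 5 * ySeq u k⌋ : ℝ) + Real.sqrt 5 * ySeq u k

/-- If `(6 + √5)^k = a + b√5` with `a b : ℤ`, then `2a = (6 + √5)^k + (6 - √5)^k`. -/
theorem two_mul_eq_pow_add_conj_pow (k : ℕ) (a b : ℤ)
    (h : ((6 : ℝ) + Real.sqrt 5) ^ k = (a : ℝ) + (b : ℝ) * Real.sqrt 5) :
    2 * (a : ℝ) = ((6 : ℝ) + Real.sqrt 5) ^ k + ((6 : ℝ) - Real.sqrt 5) ^ k := by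
  have hs : Real.sqrt 5 * Real.sqrt 5 = 5 := Real.mul_self_sqrt (by norm_num)
  have hconj : ∃ c d : ℤ, ((6 : ℝ) + Real.sqrt 5) ^ k = (c : ℝ) + (d : ℝ) * Real.sqrt 5 ∧
      ((6 : ℝ) - Real.sqrt 5) ^ k = (c : ℝ) - (d : ℝ) * Real.sqrt 5 := by
    clear h
    induction k with
    | zero => exact ⟨1, 0, by simp, by simp⟩
    | succ n ih =>
      obtain ⟨c, d, h₁, h₂⟩ := ih
      refine ⟨6 * c + 5 * d, c + 6 * d, ?_, ?_⟩
      · rw [pow_succ, h₁]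
        push_cast
        linear_combination (d : ℝ) * hs
      · rw [pow_succ, h₂]
        push_cast
        linear_combination (d : ℝ) * hs
  obtain ⟨c, d, h₁, h₂⟩ := hconj
  have hirr : Irrational (Real.sqrt 5) := by
    simpa using (show Nat.Prime 5 by norm_num).irrational_sqrt
  have hbd : b = d := by
    by_contra hne
    have hne' : b - d ≠ 0 := sub_ne_zero.mpr hne
    refine (hirr.intCast_mul hne').ne_int (c - a) ?_
    push_cast
    linarith
  subst hbd
  linarith

/-- Rounding estimate: `β = 2sa - η` and `α = x + δ` with bounded `η`, `δ`, where `s = √5`. -/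
theorem abs_sq_sub_mul_sq_sub_le {s a x η δ r : ℝ} (hs₀ : 2 ≤ s) (hs₁ : s ≤ 9 / 4)
    (hs : s ^ 2 = 5) (ha : 10 ≤ a) (hx₀ : 0 ≤ x) (hxa : x ≤ 3 * a) (hη₀ : 0 ≤ η)
    (hη₁ : η ≤ 11 / 2) (hδ₀ : 0 ≤ δ) (hδ₁ : δ ≤ 13 / 4) (hr : 20 * a ^ 2 = r + s * x ^ 2) :
    |(2 * s * a - η) ^ 2 - s * (x + δ) ^ 2 - r| ≤ 50 * (2 * s * a - η) := by
  have hE : (2 * s * a - η) ^ 2 - s * (x + δ) ^ 2 - r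
      = η ^ 2 - 4 * (s * a * η) - s * (2 * (x * δ) + δ ^ 2) := by
    linear_combination 4 * a ^ 2 * hs + hr
  have hsa : 2 * a ≤ s * a := by gcongr
  have hsaη₀ : 0 ≤ s * a * η := by positivity
  have hsaη₁ : s * a * η ≤ 9 / 4 * a * (11 / 2) := by gcongr
  have hη : η ^ 2 ≤ (11 / 2) ^ 2 := by gcongr
  have hsδ₀ : 0 ≤ s * (2 * (x * δ) + δ ^ 2) := by positivity
  have hsδ₁ : s * (2 * (x * δ) + δ ^ 2) ≤
      9 / 4 * (2 * (3 * a * (13 / 4)) + (13 / 4) ^ 2) := by gcongr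
  have hη₂ : 0 ≤ η ^ 2 := sq_nonneg η
  rw [hE, abs_le]
  constructor <;> linarith

/-- There is a constant `C > 0` such that for all large `k`,
`|β_k² − √5·α_k² − (6 + √5)^k| ≤ C·β_k`; that is,
`ε_k = (6 + √5)^k + √5·α_k² − β_k²` is `O(β_k)`. -/
theorem epsilon_is_bigO_beta (u v : ℕ → ℤ)
    (huv : ∀ k, ((6 : ℝ) + Real.sqrt 5) ^ k = (u k : ℝ) + (v k : ℝ) * Real.sqrt 5) :
    ∃ C : ℝ, 0 < C ∧ ∀ᶠ k in atTop,
      |betaSeq u k ^ 2 - Real.sqrt 5 * alphaSeq k ^ 2 - ((6 : ℝ) + Real.sqrt 5) ^ k| ≤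
        C * betaSeq u k := by
  refine ⟨50, by norm_num, ?_⟩
  have hs₀ : 2 ≤ Real.sqrt 5 := Real.le_sqrt_of_sq_le (by norm_num)
  have hs₁ : Real.sqrt 5 ≤ 9 / 4 := Real.sqrt_le_iff.mpr (by norm_num)
  have hs : Real.sqrt 5 ^ 2 = 5 := Real.sq_sqrt (by norm_num)
  have hlarge := (tendsto_pow_atTop_atTop_of_one_lt
    (show 1 < (6 : ℝ) + Real.sqrt 5 by linarith)).eventually_ge_atTop 2000
  filter_upwards [hlarge] with k hk
  have hu := two_mul_eq_pow_add_conj_pow k (u k) (v k) (huv k)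
  have hS : 0 ≤ ((6 : ℝ) - Real.sqrt 5) ^ k := pow_nonneg (by linarith) k
  have hx₀ : 0 ≤ xSeq k := Real.sqrt_nonneg _
  have hx : Real.sqrt 5 * xSeq k ^ 2 = ((6 : ℝ) - Real.sqrt 5) ^ k := by
    rw [xSeq, Real.sq_sqrt (by positivity)]
    field_simp
  set a := Real.sqrt ((u k : ℝ) / 10)
  have ha₂ : a ^ 2 = (u k : ℝ) / 10 := Real.sq_sqrt (by linarith)
  have ha : 10 ≤ a := Real.le_sqrt_of_sq_le (by linarith)
  have hr : 20 * a ^ 2 = ((6 : ℝ) + Real.sqrt 5) ^ k + Real.sqrt 5 * xSeq k ^ 2 := by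
    rw [hx, ha₂]
    linarith
  have hxa : xSeq k ≤ 3 * a := by
    refine le_of_sq_le_sq ?_ (by linarith)
    have : 2 * xSeq k ^ 2 ≤ Real.sqrt 5 * xSeq k ^ 2 := by gcongr
    nlinarith
  have hy₀ : ySeq u k ≤ a := Int.floor_le a
  have hy₁ : a < ySeq u k + 1 := Int.lt_floor_add_one a
  have hf₀ := Int.floor_le (Real.sqrt 5 * ySeq u k)
  have hf₁ := Int.lt_floor_add_one (Real.sqrt 5 * ySeq u k)
  have hc₀ := Int.le_ceil (xSeq k)
  have hc₁ := Int.ceil_lt_add_one (xSeq k)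
  have hsy₀ : Real.sqrt 5 * ySeq u k ≤ Real.sqrt 5 * a := by gcongr
  have hsy₁ : Real.sqrt 5 * a ≤ Real.sqrt 5 * (ySeq u k + 1) := by gcongr
  have key := abs_sq_sub_mul_sq_sub_le (η := 2 * Real.sqrt 5 * a - betaSeq u k)
    (δ := alphaSeq k - xSeq k) hs₀ hs₁ hs ha hx₀ hxa
    (by rw [betaSeq]; linarith) (by rw [betaSeq]; linarith)
    (by rw [alphaSeq]; linarith) (by rw [alphaSeq]; linarith) hr
  simpa only [sub_sub_cancel, add_sub_cancel] using key
end

section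
/- The sequence of real numbers α_k² / β_k² tends to 0 as k → ∞. -/
open Filter

/-- `√5` is irrational, so coordinates in `ℤ[√5]` are unique. -/
theorem int_add_mul_sqrt_five_inj {a b c d : ℤ}
    (h : (a : ℝ) + b * Real.sqrt 5 = c + d * Real.sqrt 5) : a = c ∧ b = d := by
  have hirr : Irrational (Real.sqrt 5) := by
    simpa using Nat.Prime.irrational_sqrt (p := 5) (by norm_num)
  have hbd : b = d := by
    by_contra hne
    have h0 : ((b - d : ℤ) : ℝ) ≠ 0 := by exact_mod_cast sub_ne_zero.mpr hne
    refine hirr ⟨((c - a : ℤ) : ℚ) / ((b - d : ℤ) : ℚ), ?_⟩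
    rw [Rat.cast_div, Rat.cast_intCast, Rat.cast_intCast, div_eq_iff h0]
    push_cast
    linarith
  subst hbd
  exact ⟨by exact_mod_cast add_right_cancel h, rfl⟩

/-- Conjugation in `ℤ[√5]` sends `(6 + √5)^k` to `(6 - √5)^k`. -/
theorem six_sub_sqrt_five_pow_eq (u v : ℕ → ℤ)
    (huv : ∀ k, ((6 : ℝ) + Real.sqrt 5) ^ k = (u k : ℝ) + (v k : ℝ) * Real.sqrt 5) (k : ℕ) :
    ((6 : ℝ) - Real.sqrt 5) ^ k = (u k : ℝ) - (v k : ℝ) * Real.sqrt 5 := by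
  have hs : Real.sqrt 5 * Real.sqrt 5 = 5 := Real.mul_self_sqrt (by norm_num)
  induction k with
  | zero =>
    have h := huv 0
    obtain ⟨h1, h2⟩ := int_add_mul_sqrt_five_inj (a := 1) (b := 0) (c := u 0) (d := v 0)
      (by rw [← h]; simp)
    simp [← h1, ← h2]
  | succ k ih =>
    have h := huv (k + 1)
    rw [pow_succ, huv k] at h
    obtain ⟨h1, h2⟩ := int_add_mul_sqrt_five_inj (a := 6 * u k + 5 * v k) (b := u k + 6 * v k)
      (c := u (k + 1)) (d := v (k + 1)) (by rw [← h]; push_cast; linear_combination -(v k : ℝ) * hs)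
    rw [pow_succ, ih, ← h1, ← h2]
    push_cast
    linear_combination (v k : ℝ) * hs

theorem two_lt_sqrt_five : 2 < Real.sqrt 5 := Real.lt_sqrt_of_sq_lt (by norm_num)

theorem sqrt_five_lt_three : Real.sqrt 5 < 3 := by
  rw [Real.sqrt_lt' (by norm_num)]
  norm_num

theorem alphaSeq_nonneg (k : ℕ) : 0 ≤ alphaSeq k := by
  have h : 0 ≤ xSeq k := Real.sqrt_nonneg _
  have := Int.le_ceil (xSeq k)
  have := Real.sqrt_nonneg 5
  unfold alphaSeq
  linarith

theorem alphaSeq_le (k : ℕ) : alphaSeq k ≤ Real.sqrt (6 - Real.sqrt 5) ^ k + 4 := by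
  have h3 := sqrt_five_lt_three
  have hx : xSeq k ≤ Real.sqrt (6 - Real.sqrt 5) ^ k := by
    have h0 : 0 ≤ 6 - Real.sqrt 5 := by linarith
    refine Real.sqrt_le_iff.mpr ⟨by positivity, ?_⟩
    rw [← pow_mul, mul_comm, pow_mul, Real.sq_sqrt h0]
    exact div_le_self (by positivity) (by linarith [two_lt_sqrt_five])
  have := Int.ceil_lt_add_one (xSeq k)
  unfold alphaSeq
  linarith

theorem le_betaSeq (u v : ℕ → ℤ)
    (huv : ∀ k, ((6 : ℝ) + Real.sqrt 5) ^ k = (u k : ℝ) + (v k : ℝ) * Real.sqrt 5) (k : ℕ) :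
    4 / 5 * Real.sqrt (6 + Real.sqrt 5) ^ k - 7 ≤ betaSeq u k := by
  have h2 := two_lt_sqrt_five
  have h3 := sqrt_five_lt_three
  set R := Real.sqrt (6 + Real.sqrt 5) ^ k with hR
  have hR0 : 0 ≤ R := by positivity
  have hR2 : R ^ 2 = (6 + Real.sqrt 5) ^ k := by
    rw [hR, ← pow_mul, mul_comm, pow_mul, Real.sq_sqrt (by positivity)]
  have hu : R ^ 2 ≤ 2 * u k := by
    have hσ : 0 ≤ (6 - Real.sqrt 5) ^ k := pow_nonneg (by linarith) k
    rw [six_sub_sqrt_five_pow_eq u v huv k] at hσ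
    linarith [huv k]
  have hsqrt : R / 5 ≤ Real.sqrt (u k / 10) := Real.le_sqrt_of_sq_le (by nlinarith)
  have hy : R / 5 - 1 ≤ ySeq u k := by
    have := Int.lt_floor_add_one (Real.sqrt (u k / 10))
    unfold ySeq
    linarith
  have hβ : 2 * (Real.sqrt 5 * ySeq u k) - 1 ≤ betaSeq u k := by
    have := Int.lt_floor_add_one (Real.sqrt 5 * ySeq u k)
    unfold betaSeq
    linarith
  nlinarith [mul_le_mul_of_nonneg_left hy (Real.sqrt_nonneg 5)]

/-- The sequence `α_k² / β_k²` tends to `0`. -/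
theorem alpha_sq_div_beta_sq_tendsto_zero (u v : ℕ → ℤ)
    (huv : ∀ k, ((6 : ℝ) + Real.sqrt 5) ^ k = (u k : ℝ) + (v k : ℝ) * Real.sqrt 5) :
    Tendsto (fun k => alphaSeq k ^ 2 / betaSeq u k ^ 2) atTop (nhds 0) := by
  have h2 := two_lt_sqrt_five
  have h3 := sqrt_five_lt_three
  set a := Real.sqrt (6 - Real.sqrt 5)
  set b := Real.sqrt (6 + Real.sqrt 5)
  have hb : 1 < b := Real.lt_sqrt_of_sq_lt (by linarith)
  have hb0 : 0 < b := by linarith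
  have hab : a < b := Real.sqrt_lt_sqrt (by linarith) (by linarith)
  have hinv : Tendsto (fun k : ℕ => b⁻¹ ^ k) atTop (nhds 0) :=
    tendsto_pow_atTop_nhds_zero_of_lt_one (by positivity) (inv_lt_one_of_one_lt₀ hb)
  have hdiv : Tendsto (fun k : ℕ => (a / b) ^ k) atTop (nhds 0) :=
    tendsto_pow_atTop_nhds_zero_of_lt_one (by positivity) ((div_lt_one hb0).mpr hab)
  have hbound : Tendsto (fun k : ℕ => ((a / b) ^ k + 4 * b⁻¹ ^ k) / (4 / 5 - 7 * b⁻¹ ^ k))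
      atTop (nhds 0) := by
    simpa [Pi.div_def] using (hdiv.add (hinv.const_mul 4)).div
      ((tendsto_const_nhds (x := (4 / 5 : ℝ))).sub (hinv.const_mul 7)) (by norm_num)
  have hlarge : ∀ᶠ k : ℕ in atTop, 9 < b ^ k :=
    (tendsto_pow_atTop_atTop_of_one_lt hb).eventually_gt_atTop 9
  have hratio : Tendsto (fun k => alphaSeq k / betaSeq u k) atTop (nhds 0) := by
    refine tendsto_of_tendsto_of_tendsto_of_le_of_le' tendsto_const_nhds hbound ?_ ?_
    · filter_upwards [hlarge] with k hk
      exact div_nonneg (alphaSeq_nonneg k) (by linarith [le_betaSeq u v huv k])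
    · filter_upwards [hlarge] with k hk
      calc alphaSeq k / betaSeq u k ≤ (a ^ k + 4) / (4 / 5 * b ^ k - 7) :=
            div_le_div₀ (by positivity) (alphaSeq_le k) (by linarith) (le_betaSeq u v huv k)
        _ = ((a / b) ^ k + 4 * b⁻¹ ^ k) / (4 / 5 - 7 * b⁻¹ ^ k) := by
            rw [← mul_div_mul_right _ (4 / 5 - 7 * b⁻¹ ^ k) (pow_pos hb0 k).ne', div_pow, inv_pow]
            have := (pow_pos hb0 k).ne'
            congr 1 <;> field_simp
  simpa [div_pow] using hratio.pow 2
end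

section
/- The sequence of real numbers α_k⁴ / β_k² tends to +∞ as k → ∞. -/
open Filter

theorem eq_of_add_mul_irrational_eq {s : ℝ} (hs : Irrational s) {a b c d : ℤ}
    (h : (a : ℝ) + b * s = c + d * s) : a = c := by
  by_cases hbd : b = d
  · subst hbd
    exact_mod_cast add_right_cancel h
  · have hne : ((b - d : ℤ) : ℝ) ≠ 0 := by exact_mod_cast sub_ne_zero.mpr hbd
    refine absurd ⟨((c - a : ℤ) : ℚ) / ((b - d : ℤ) : ℚ), ?_⟩ hs
    push_cast at hne ⊢
    rw [div_eq_iff hne]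
    linarith

theorem exists_six_add_sqrt_five_pow (k : ℕ) :
    ∃ a b : ℤ, 6 ^ k ≤ a ∧ 0 ≤ b ∧ ((6 : ℝ) + Real.sqrt 5) ^ k = a + b * Real.sqrt 5 := by
  induction k with
  | zero => exact ⟨1, 0, by simp⟩
  | succ k ih =>
    obtain ⟨a, b, ha, hb, h⟩ := ih
    have h5 : Real.sqrt 5 * Real.sqrt 5 = 5 := Real.mul_self_sqrt (by norm_num)
    have h6 : (0 : ℤ) < 6 ^ k := by positivity
    refine ⟨6 * a + 5 * b, a + 6 * b, by rw [pow_succ]; linarith, by linarith, ?_⟩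
    rw [pow_succ, h]
    push_cast
    linear_combination (b : ℝ) * h5

theorem rational_part_bounds {u v : ℕ → ℤ}
    (huv : ∀ k, ((6 : ℝ) + Real.sqrt 5) ^ k = (u k : ℝ) + (v k : ℝ) * Real.sqrt 5) (k : ℕ) :
    (6 : ℝ) ^ k ≤ u k ∧ (u k : ℝ) ≤ (6 + Real.sqrt 5) ^ k := by
  obtain ⟨a, b, ha, hb, h⟩ := exists_six_add_sqrt_five_pow k
  have hirr : Irrational (Real.sqrt 5) := by
    simpa using (show Nat.Prime 5 by norm_num).irrational_sqrt
  obtain rfl : u k = a := eq_of_add_mul_irrational_eq hirr ((huv k).symm.trans h)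
  have hb' : (0 : ℝ) ≤ b := by exact_mod_cast hb
  have : 0 ≤ (b : ℝ) * Real.sqrt 5 := by positivity
  exact ⟨by exact_mod_cast ha, by linarith⟩

theorem sqrt_five_bounds : 2.2 < Real.sqrt 5 ∧ Real.sqrt 5 < 2.3 :=
  ⟨by rw [Real.lt_sqrt] <;> norm_num, by rw [Real.sqrt_lt'] <;> norm_num⟩

theorem le_alphaSeq_pow_four (k : ℕ) :
    ((6 - Real.sqrt 5) ^ 2) ^ k / 5 ≤ alphaSeq k ^ 4 := by
  have hs := sqrt_five_bounds
  have hnn : 0 ≤ (6 - Real.sqrt 5) ^ k / Real.sqrt 5 :=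
    div_nonneg (pow_nonneg (by linarith) _) (Real.sqrt_nonneg _)
  have hx : xSeq k ≤ alphaSeq k :=
    (Int.le_ceil _).trans (le_add_of_nonneg_right (Real.sqrt_nonneg _))
  calc ((6 - Real.sqrt 5) ^ 2) ^ k / 5
      = (xSeq k ^ 2) ^ 2 := by
        rw [xSeq, Real.sq_sqrt hnn, div_pow, Real.sq_sqrt (by norm_num), pow_right_comm]
    _ = xSeq k ^ 4 := by ring
    _ ≤ alphaSeq k ^ 4 := pow_le_pow_left₀ (Real.sqrt_nonneg _) hx 4

theorem betaSeq_sq_le {u : ℕ → ℤ} {k : ℕ} (hu : 0 ≤ u k) : betaSeq u k ^ 2 ≤ 2 * u k := by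
  have hu' : (0 : ℝ) ≤ u k := by exact_mod_cast hu
  have hy : 0 ≤ ySeq u k := by
    rw [ySeq, Int.cast_nonneg_iff]
    exact Int.floor_nonneg.mpr (Real.sqrt_nonneg _)
  have hys : 0 ≤ Real.sqrt 5 * ySeq u k := mul_nonneg (Real.sqrt_nonneg _) hy
  have hb0 : 0 ≤ betaSeq u k := by
    have : (0 : ℝ) ≤ ⌊Real.sqrt 5 * ySeq u k⌋ := by exact_mod_cast Int.floor_nonneg.mpr hys
    exact add_nonneg this hys
  have hb : betaSeq u k ≤ 2 * (Real.sqrt 5 * ySeq u k) := by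
    have := Int.floor_le (Real.sqrt 5 * ySeq u k)
    rw [betaSeq]
    linarith
  have hy2 : ySeq u k ^ 2 ≤ u k / 10 := by
    rw [← Real.sq_sqrt (show 0 ≤ (u k : ℝ) / 10 by positivity)]
    exact pow_le_pow_left₀ hy (Int.floor_le _) 2
  calc betaSeq u k ^ 2 ≤ (2 * (Real.sqrt 5 * ySeq u k)) ^ 2 := pow_le_pow_left₀ hb0 hb 2
    _ = 20 * ySeq u k ^ 2 := by
      rw [mul_pow, mul_pow, Real.sq_sqrt (by norm_num)]
      ring
    _ ≤ 2 * u k := by linarith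

theorem betaSeq_pos {u : ℕ → ℤ} {k : ℕ} (hu : 10 ≤ u k) : 0 < betaSeq u k := by
  have hu' : (10 : ℝ) ≤ u k := by exact_mod_cast hu
  have hy : 1 ≤ ySeq u k := by
    rw [ySeq, ← Int.cast_one, Int.cast_le, Int.le_floor, Int.cast_one, Real.one_le_sqrt]
    linarith
  have hys : 0 < Real.sqrt 5 * ySeq u k := mul_pos (by positivity) (by linarith)
  have : (0 : ℝ) ≤ ⌊Real.sqrt 5 * ySeq u k⌋ := by exact_mod_cast Int.floor_nonneg.mpr hys.le
  exact add_pos_of_nonneg_of_pos this hys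

/-- The sequence `α_k⁴ / β_k²` tends to `+∞`. -/
theorem alpha_pow_four_div_beta_sq_tendsto_atTop (u v : ℕ → ℤ)
    (huv : ∀ k, ((6 : ℝ) + Real.sqrt 5) ^ k = (u k : ℝ) + (v k : ℝ) * Real.sqrt 5) :
    Tendsto (fun k => alphaSeq k ^ 4 / betaSeq u k ^ 2) atTop atTop := by
  have hs := sqrt_five_bounds
  have hratio : 1 < (6 - Real.sqrt 5) ^ 2 / (6 + Real.sqrt 5) := by
    rw [one_lt_div (by positivity)]
    nlinarith
  refine tendsto_atTop_mono' atTop ?_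
    ((tendsto_pow_atTop_atTop_of_one_lt hratio).atTop_div_const (show (0 : ℝ) < 10 by norm_num))
  filter_upwards [eventually_ge_atTop 2] with k hk
  obtain ⟨hlow, hup⟩ := rational_part_bounds huv k
  have h36 : (6 : ℝ) ^ 2 ≤ 6 ^ k := pow_le_pow_right₀ (by norm_num) hk
  have hu : 10 ≤ u k := by
    have : (10 : ℝ) ≤ u k := by linarith
    exact_mod_cast this
  have hβ : betaSeq u k ^ 2 ≤ 2 * (6 + Real.sqrt 5) ^ k :=
    (betaSeq_sq_le (by linarith)).trans (by linarith)
  calc ((6 - Real.sqrt 5) ^ 2 / (6 + Real.sqrt 5)) ^ k / 10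
      = ((6 - Real.sqrt 5) ^ 2) ^ k / 5 / (2 * (6 + Real.sqrt 5) ^ k) := by
        rw [div_pow, div_div, div_div]
        ring
    _ ≤ alphaSeq k ^ 4 / betaSeq u k ^ 2 :=
        div_le_div₀ (by positivity) (le_alphaSeq_pow_four k) (pow_pos (betaSeq_pos hu) 2) hβ
end

section
/- The sequence of real numbers (6 + √5)^k / β_k² tends to 1 as k → ∞. -/
open Filter

/-- Powers of `6 ± √5` have conjugate integer coordinates. -/
theorem exists_conj_coords (k : ℕ) : ∃ a b : ℤ,
    ((6 : ℝ) + Real.sqrt 5) ^ k = a + b * Real.sqrt 5 ∧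
    ((6 : ℝ) - Real.sqrt 5) ^ k = a - b * Real.sqrt 5 := by
  induction k with
  | zero => exact ⟨1, 0, by simp, by simp⟩
  | succ k ih =>
    obtain ⟨a, b, h₁, h₂⟩ := ih
    have h5 : Real.sqrt 5 ^ 2 = 5 := Real.sq_sqrt (by norm_num)
    refine ⟨6 * a + 5 * b, a + 6 * b, ?_, ?_⟩
    · rw [pow_succ, h₁]
      push_cast
      linear_combination (b : ℝ) * h5
    · rw [pow_succ, h₂]
      push_cast
      linear_combination (b : ℝ) * h5

theorem tendsto_int_floor_div_self_atTop :
    Tendsto (fun x : ℝ => (⌊x⌋ : ℝ) / x) atTop (nhds 1) := by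
  refine (tendsto_nat_floor_div_atTop (R := ℝ)).congr' ?_
  filter_upwards [eventually_ge_atTop 0] with x hx
  rw [natCast_floor_eq_intCast_floor hx]

/-- The sequence `(6 + √5)^k / β_k²` tends to `1`. -/
theorem rho_pow_div_beta_sq_tendsto_one (u v : ℕ → ℤ)
    (huv : ∀ k, ((6 : ℝ) + Real.sqrt 5) ^ k = (u k : ℝ) + (v k : ℝ) * Real.sqrt 5) :
    Tendsto (fun k => ((6 : ℝ) + Real.sqrt 5) ^ k / betaSeq u k ^ 2) atTop (nhds 1) := by
  have h5 : Real.sqrt 5 ^ 2 = 5 := Real.sq_sqrt (by norm_num)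
  have hpos : 0 < Real.sqrt 5 := by positivity
  have hlt : Real.sqrt 5 < 6 := by nlinarith
  have hu : ∀ k, 2 * (u k : ℝ) = (6 + Real.sqrt 5) ^ k + (6 - Real.sqrt 5) ^ k := by
    intro k
    obtain ⟨a, b, h₁, h₂⟩ := exists_conj_coords k
    obtain ⟨rfl, rfl⟩ := int_add_mul_sqrt_five_inj (h₁.symm.trans (huv k))
    rw [h₁, h₂]
    ring
  have hσ : ∀ k, 0 < (6 - Real.sqrt 5) ^ k := fun k => pow_pos (by linarith) k
  have hρ : ∀ k, 0 < (6 + Real.sqrt 5) ^ k := fun k => by positivity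
  have hu_pos : ∀ k, 0 < (u k : ℝ) := fun k => by linarith [hu k, hσ k, hρ k]
  have hratio : Tendsto (fun k => (6 + Real.sqrt 5) ^ k / ((u k : ℝ) / 10)) atTop (nhds 20) := by
    have hgeom : Tendsto (fun k : ℕ => ((6 - Real.sqrt 5) / (6 + Real.sqrt 5)) ^ k) atTop
        (nhds 0) :=
      tendsto_pow_atTop_nhds_zero_of_lt_one (div_nonneg (by linarith) (by linarith))
        ((div_lt_one (by linarith)).mpr (by linarith))
    have hlim := (tendsto_const_nhds (x := (20 : ℝ))).div (hgeom.const_add 1) (by norm_num)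
    rw [add_zero, div_one] at hlim
    refine hlim.congr fun k => ?_
    have hk := hρ k
    have hsk := hσ k
    have huk : (u k : ℝ) = ((6 + Real.sqrt 5) ^ k + (6 - Real.sqrt 5) ^ k) / 2 := by
      linarith [hu k]
    rw [Pi.div_apply, huk, div_pow]
    field_simp
    norm_num
  have hs : Tendsto (fun k => Real.sqrt ((u k : ℝ) / 10)) atTop atTop := by
    have hpow : Tendsto (fun k : ℕ => (6 + Real.sqrt 5) ^ k / 20) atTop atTop :=
      (tendsto_pow_atTop_atTop_of_one_lt (by linarith)).atTop_div_const (by norm_num)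
    exact Real.tendsto_sqrt_atTop.comp
      (tendsto_atTop_mono (fun k => by linarith [hu k, hσ k]) hpow)
  have hys : Tendsto (fun k => ySeq u k / Real.sqrt ((u k : ℝ) / 10)) atTop (nhds 1) :=
    tendsto_int_floor_div_self_atTop.comp hs
  have hy : Tendsto (fun k => Real.sqrt 5 * ySeq u k) atTop atTop :=
    (tendsto_intCast_atTop_atTop.comp (tendsto_floor_atTop.comp hs)).const_mul_atTop hpos
  have hβ : Tendsto (fun k => betaSeq u k / Real.sqrt ((u k : ℝ) / 10)) atTop
      (nhds ((1 + 1) * (Real.sqrt 5 * 1))) := by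
    refine (((tendsto_int_floor_div_self_atTop.comp hy).add_const 1).mul
      (hys.const_mul (Real.sqrt 5))).congr' ?_
    filter_upwards [hy.eventually_gt_atTop 0] with k hk
    have hyk : ySeq u k ≠ 0 := right_ne_zero_of_mul hk.ne'
    simp only [Function.comp_apply, betaSeq]
    field_simp
  have hlim := hratio.div (hβ.pow 2) (by positivity)
  have hone : (20 : ℝ) / ((1 + 1) * (Real.sqrt 5 * 1)) ^ 2 = 1 := by
    rw [mul_pow, mul_one, h5]
    norm_num
  rw [hone] at hlim
  refine hlim.congr fun k => ?_
  have huk : 0 < (u k : ℝ) / 10 := div_pos (hu_pos k) (by norm_num)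
  rw [Pi.div_apply, div_pow, Real.sq_sqrt huk.le, div_div_div_cancel_right₀ huk.ne']
end

section
/- Let n ≥ 4 and let f be the quadratic form f(x) = −√5·x₀² + x₁² + ⋯ + x_n², evaluated on real vectors (with √5 the positive square root of 5). There exists a sequence (w_k) of vectors in ℝ^{n+1}, all of whose coordinates lie in the ring of integers 𝒪_K = ℤ[(1+√5)/2] of ℚ(√5) (viewed inside ℝ via the embedding sending √5 to the positive square root), such that: (i) f(w_k) = (6 + √5)^k for every k ≥ 1; (ii) for all sufficiently large k, (w_k)₁² > f(w_k) > 0, where (w_k)₁ denotes the coordinate of w_k of index 1; and (iii) the sequence of real numbers (w_k)₁² / f(w_k) tends to 1 as k → ∞. -/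
open Filter

/-- The quadratic form `f(x) = −√5·x₀² + x₁² + ⋯ + x_n²` on `ℝ^{n+1}`. -/
noncomputable def qForm (n : ℕ) (w : Fin (n + 1) → ℝ) : ℝ :=
  -Real.sqrt 5 * (w 0) ^ 2 + ∑ i ∈ Finset.Ioi (0 : Fin (n + 1)), (w i) ^ 2

namespace GoldenForm

/-- The ring `ℤ[(1+√5)/2]` inside `ℝ`. -/
noncomputable abbrev goldenRing : Subring ℝ := Subring.closure {((1 + Real.sqrt 5) / 2 : ℝ)}

/-- The positive fourth root of `5`. -/
noncomputable def root : ℝ := √(√5)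

lemma root_sq : root ^ 2 = √5 := Real.sq_sqrt (Real.sqrt_nonneg 5)

lemma root_pow_four : root ^ 4 = 5 := by
  rw [show root ^ 4 = (root ^ 2) ^ 2 by ring, root_sq, Real.sq_sqrt (by norm_num)]

lemma root_pos : 0 < root := Real.sqrt_pos.2 (Real.sqrt_pos.2 (by norm_num))

lemma one_lt_root : 1 < root := by
  by_contra! h
  have := pow_le_one₀ (n := 4) root_pos.le h
  rw [root_pow_four] at this
  norm_num at this

/-- The square root of `6 + √5`. -/
noncomputable def scale : ℝ := √(6 + root ^ 2)

lemma scale_sq : scale ^ 2 = 6 + root ^ 2 := Real.sq_sqrt (by positivity)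

lemma scale_pos : 0 < scale := Real.sqrt_pos.2 (by positivity)

lemma golden_mem : (1 + root ^ 2) / 2 ∈ goldenRing := by
  rw [root_sq]
  exact Subring.subset_closure rfl

lemma root_sq_mem : root ^ 2 ∈ goldenRing := by
  have h := sub_mem (add_mem golden_mem golden_mem) (one_mem goldenRing)
  convert h using 1
  ring

/-- There is a point of `ℤ[(1+√5)/2]²` on the hyperbola `x² - √5 y² = (6+√5)^k` with hyperbolic
angle `t`. -/
def Represents (k : ℕ) (t : ℝ) : Prop :=
  ∃ a ∈ goldenRing, ∃ b ∈ goldenRing,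
    a = scale ^ k * Real.cosh t ∧ root * b = scale ^ k * Real.sinh t

namespace Represents

lemma zero : Represents 0 0 :=
  ⟨1, one_mem _, 0, zero_mem _, by simp, by simp⟩

lemma two : Represents 2 0 :=
  ⟨6 + root ^ 2, add_mem (ofNat_mem _ 6) root_sq_mem, 0, zero_mem _, by simp [scale_sq], by simp⟩

lemma neg {k : ℕ} {t : ℝ} (h : Represents k t) : Represents k (-t) := by
  obtain ⟨a, ha, b, hb, h1, h2⟩ := h
  exact ⟨a, ha, -b, neg_mem hb, by simpa using h1, by simpa using h2⟩

lemma add {k l : ℕ} {s t : ℝ} (h : Represents k s) (h' : Represents l t) :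
    Represents (k + l) (s + t) := by
  obtain ⟨a, ha, b, hb, h1, h2⟩ := h
  obtain ⟨c, hc, d, hd, h3, h4⟩ := h'
  refine ⟨a * c + root ^ 2 * (b * d),
    add_mem (mul_mem ha hc) (mul_mem root_sq_mem (mul_mem hb hd)),
    a * d + b * c, add_mem (mul_mem ha hd) (mul_mem hb hc), ?_, ?_⟩
  · rw [Real.cosh_add, pow_add]
    linear_combination c * h1 + scale ^ k * Real.cosh s * h3 +
      root * d * h2 + scale ^ k * Real.sinh s * h4
  · rw [Real.sinh_add, pow_add]
    linear_combination (root * d) * h1 + scale ^ k * Real.cosh s * h4 + c * h2 +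
      scale ^ k * Real.sinh s * h3

lemma nat_mul {k : ℕ} {t : ℝ} (h : Represents k t) (m : ℕ) : Represents (m * k) (m * t) := by
  induction m with
  | zero => simpa using zero
  | succ m ih =>
    have := ih.add h
    rwa [← Nat.succ_mul, show (m : ℝ) * t + t = ((m + 1 : ℕ) : ℝ) * t by push_cast; ring] at this

lemma int_mul {k : ℕ} {t : ℝ} (h : Represents k t) (c : ℤ) :
    Represents (c.natAbs * k) (c * t) := by
  obtain hc | hc := Int.natAbs_eq c
  · have := h.nat_mul c.natAbs
    rwa [show ((c.natAbs : ℕ) : ℝ) = c by rw [hc]; simp] at this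
  · have := h.neg.nat_mul c.natAbs
    rwa [show ((c.natAbs : ℕ) : ℝ) * -t = c * t by rw [hc]; simp] at this

lemma add_even {k : ℕ} {t : ℝ} (h : Represents k t) (j : ℕ) : Represents (k + j * 2) t := by
  simpa using h.add (two.nat_mul j)

end Represents

/-- The hyperbolic angle of the point `(1+√5, 1)` of norm `6+√5`. -/
noncomputable def primeAngle : ℝ := Real.log ((1 + root ^ 2 + root) / scale)

/-- The hyperbolic angle of a unit of norm one. -/
noncomputable def unitAngle : ℝ :=
  Real.log ((1 + root ^ 2) / 2 * ((1 + root ^ 2) / 2 + root))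

lemma conj_pos : 0 < 1 + root ^ 2 - root := by nlinarith [sq_nonneg (root - 1), root_pos]

lemma represents_primeAngle : Represents 1 primeAngle := by
  have h0 := root_pos
  have hs := scale_pos
  have hb : 0 < 1 + root ^ 2 + root := by positivity
  have key : scale * ((1 + root ^ 2 + root) / scale)⁻¹ = 1 + root ^ 2 - root := by
    rw [inv_div]
    field_simp
    rw [scale_sq]
    linear_combination -root_pow_four
  have key' : scale * ((1 + root ^ 2 + root) / scale) = 1 + root ^ 2 + root := by
    field_simp
  refine ⟨1 + root ^ 2, add_mem (one_mem _) root_sq_mem, 1, one_mem _, ?_, ?_⟩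
  · rw [primeAngle, Real.cosh_log (by positivity)]
    linear_combination -(key + key') / 2
  · rw [primeAngle, Real.sinh_log (by positivity)]
    linear_combination (key - key') / 2

lemma represents_unitAngle : Represents 0 unitAngle := by
  have h0 := root_pos
  have key : ((1 + root ^ 2) / 2 * ((1 + root ^ 2) / 2 + root))⁻¹ =
      (1 + root ^ 2) / 2 * ((1 + root ^ 2) / 2 - root) := by
    rw [inv_eq_iff_eq_inv]
    apply eq_inv_of_mul_eq_one_left
    linear_combination (root ^ 4 + 3) / 16 * root_pow_four
  refine ⟨((1 + root ^ 2) / 2) ^ 2, pow_mem golden_mem 2, _, golden_mem, ?_, ?_⟩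
  · rw [unitAngle, Real.cosh_log (by positivity), key]
    ring
  · rw [unitAngle, Real.sinh_log (by positivity), key]
    ring

lemma unitAngle_pos : 0 < unitAngle := by
  apply Real.log_pos
  nlinarith [one_lt_root, sq_nonneg (root - 1)]

lemma two_mul_primeAngle :
    2 * primeAngle = Real.log (1 + root ^ 2 + root) - Real.log (1 + root ^ 2 - root) := by
  have h0 := root_pos
  have h : 6 + root ^ 2 = (1 + root ^ 2 + root) * (1 + root ^ 2 - root) := by
    linear_combination -root_pow_four
  rw [primeAngle, Real.log_div (by positivity) scale_pos.ne', scale, Real.log_sqrt (by positivity),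
    h, Real.log_mul (by positivity) conj_pos.ne']
  ring

lemma primeAngle_pos : 0 < primeAngle := by
  have := Real.log_lt_log conj_pos (by linarith [root_pos] : _ < 1 + root ^ 2 + root)
  linarith [two_mul_primeAngle]

open Polynomial in
lemma minpoly_root : minpoly ℤ root = X ^ 4 - 5 := by
  have hd : (X ^ 4 - 5 : ℤ[X]).natDegree = 4 := by compute_degree!
  have hm : (X ^ 4 - 5 : ℤ[X]).Monic := by monicity!
  have hp : (Ideal.span {(5 : ℤ)}).IsPrime :=
    (Ideal.span_singleton_prime (by norm_num)).2 (Int.prime_iff_natAbs_prime.2 (by norm_num))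
  have hirr : Irreducible (X ^ 4 - 5 : ℤ[X]) := by
    apply irreducible_of_eisenstein_criterion hp
    · rw [hm.leadingCoeff, ← Ideal.eq_top_iff_one]
      exact hp.ne_top
    · intro n hn
      rw [degree_eq_natDegree hm.ne_zero, hd] at hn
      have hn : n < 4 := by exact_mod_cast hn
      rw [Ideal.mem_span_singleton]
      interval_cases n <;> simp [coeff_X_pow, coeff_ofNat_succ]
    · rw [← natDegree_pos_iff_degree_pos, hd]
      norm_num
    · rw [Ideal.span_singleton_pow, Ideal.mem_span_singleton]
      simp [coeff_X_pow]
    · exact hm.isPrimitive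
  have hr : aeval root (X ^ 4 - 5 : ℤ[X]) = 0 := by simp [root_pow_four, map_ofNat (aeval root) 5]
  have hi : IsIntegral ℤ root := ⟨_, hm, hr⟩
  have hdvd := minpoly.isIntegrallyClosed_dvd hi hr
  exact eq_of_monic_of_associated (minpoly.monic hi) hm
    ((minpoly.irreducible hi).associated_of_dvd hirr hdvd)

open Polynomial in
/-- Evaluation of polynomials at `5` modulo `31` factors through evaluation at `5 ^ (1 / 4)`. -/
lemma dvd_eval_of_aeval_root {p : ℤ[X]} (h : aeval root p = 0) : 31 ∣ p.eval 5 := by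
  have hi : IsIntegral ℤ root := ⟨X ^ 4 - 5, by monicity!, by simp [root_pow_four]⟩
  obtain ⟨q, rfl⟩ := minpoly_root ▸ minpoly.isIntegrallyClosed_dvd hi h
  refine Dvd.dvd.trans ?_ (dvd_of_eq (eval_mul).symm)
  exact Dvd.dvd.mul_right (by simp) _

open Polynomial in
lemma pow_ne_unit_mul_pow {p : ℕ} (hp : 0 < p) (q : ℕ) :
    (1 + root ^ 2 + root) ^ p ≠
      ((1 + root ^ 2) / 2 * ((1 + root ^ 2) / 2 + root)) ^ q * (1 + root ^ 2 - root) ^ p := by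
  intro h
  have h4 : (4 : ℝ) ^ q * (1 + root ^ 2 + root) ^ p =
      ((1 + root ^ 2) * (1 + root ^ 2 + 2 * root)) ^ q * (1 + root ^ 2 - root) ^ p := by
    rw [h, ← mul_assoc, ← mul_pow]
    ring_nf
  have hroot : aeval root ((4 : ℤ[X]) ^ q * (1 + X ^ 2 + X) ^ p -
      ((1 + X ^ 2) * (1 + X ^ 2 + 2 * X)) ^ q * (1 + X ^ 2 - X) ^ p) = 0 := by
    simp [map_ofNat (aeval root), h4]
  have hdvd := dvd_eval_of_aeval_root hroot
  simp only [eval_sub, eval_mul, eval_pow, eval_add, eval_X, eval_one, eval_ofNat] at hdvd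
  norm_num at hdvd
  have h31 : Prime (31 : ℤ) := Int.prime_iff_natAbs_prime.2 (by norm_num)
  have hl : (31 : ℤ) ∣ 4 ^ q * 31 ^ p := Dvd.dvd.mul_left (dvd_pow_self _ hp.ne') _
  rcases h31.dvd_or_dvd ((dvd_sub_right hl).1 hdvd) with h' | h' <;>
  · have := h31.dvd_of_dvd_pow h'
    norm_num at this

lemma irrational_angle_ratio : Irrational (2 * primeAngle / unitAngle) := by
  have h0 := root_pos
  rintro ⟨r, hr⟩
  have hpos : 0 < (r : ℝ) := hr ▸ div_pos (mul_pos two_pos primeAngle_pos) unitAngle_pos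
  have hr0 : 0 < r.num := Rat.num_pos.2 (by exact_mod_cast hpos)
  obtain ⟨q, hq⟩ := Int.eq_ofNat_of_zero_le hr0.le
  have hrd : (r : ℝ) = q / r.den := by
    rw [Rat.cast_def, hq]
    simp
  have hden : (0 : ℝ) < r.den := by exact_mod_cast r.pos
  rw [hrd, div_eq_div_iff hden.ne' unitAngle_pos.ne', two_mul_primeAngle, unitAngle] at hr
  apply pow_ne_unit_mul_pow r.pos q
  have hc := conj_pos
  apply Real.log_injOn_pos (Set.mem_Ioi.2 (by positivity)) (Set.mem_Ioi.2 (by positivity))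
  rw [Real.log_mul (by positivity) (by positivity), Real.log_pow, Real.log_pow, Real.log_pow]
  linarith

lemma exists_represents_small {δ : ℝ} (hδ : 0 < δ) (r : ℕ) :
    ∃ t, 0 < t ∧ t < δ ∧ ∃ m : ℕ, ∀ j : ℕ, Represents (2 * (m + j) + r) t := by
  have hd := dense_addSubgroupClosure_pair_iff.2 irrational_angle_ratio
  obtain ⟨x, hx, h1, h2⟩ := hd.exists_between
    (show -(r * primeAngle) < -(r * primeAngle) + δ by linarith)
  obtain ⟨c, i, rfl⟩ := AddSubgroup.mem_closure_pair.1 hx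
  simp only [zsmul_eq_mul] at h1 h2
  refine ⟨c * (2 * primeAngle) + i * unitAngle + r * primeAngle, by linarith, by linarith,
    c.natAbs, fun j => ?_⟩
  have hc := represents_primeAngle.int_mul c
  have h := (((hc.add hc).add (represents_unitAngle.int_mul i)).add
    (represents_primeAngle.nat_mul r)).add_even j
  convert h using 1 <;> ring

lemma eventually_exists_represents {δ : ℝ} (hδ : 0 < δ) :
    ∀ᶠ k in atTop, ∃ t, 0 < t ∧ t < δ ∧ Represents k t := by
  obtain ⟨t, ht, htδ, m, h⟩ := exists_represents_small hδ 0
  obtain ⟨t', ht', htδ', m', h'⟩ := exists_represents_small hδ 1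
  filter_upwards [eventually_ge_atTop (2 * (m + m') + 1)] with k hk
  rcases Nat.even_or_odd' k with ⟨l, rfl | rfl⟩
  · refine ⟨t, ht, htδ, ?_⟩
    convert h (l - m) using 1
    omega
  · refine ⟨t', ht', htδ', ?_⟩
    convert h' (l - m') using 1
    omega

lemma exists_pos_represents (k : ℕ) : ∃ t, 0 < t ∧ Represents k t := by
  refine ⟨k * primeAngle + unitAngle,
    add_pos_of_nonneg_of_pos (mul_nonneg k.cast_nonneg primeAngle_pos.le) unitAngle_pos, ?_⟩
  simpa using (represents_primeAngle.nat_mul k).add represents_unitAngle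

lemma exists_seq_represents :
    ∃ t : ℕ → ℝ, (∀ k, 0 < t k) ∧ (∀ k, Represents k (t k)) ∧ Tendsto t atTop (nhds 0) := by
  have hbdd (k : ℕ) : BddBelow {t | 0 < t ∧ Represents k t} := ⟨0, fun t ht => ht.1.le⟩
  choose t ht hlt using fun k : ℕ => Real.lt_sInf_add_pos
    (s := {t | 0 < t ∧ Represents k t}) (exists_pos_represents k)
    (Nat.one_div_pos_of_nat (α := ℝ) (n := k))
  refine ⟨t, fun k => (ht k).1, fun k => (ht k).2, ?_⟩
  rw [tendsto_order]
  refine ⟨fun a ha => Eventually.of_forall fun k => ha.trans (ht k).1, fun δ hδ => ?_⟩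
  have hsmall := (tendsto_one_div_add_atTop_nhds_zero_nat (𝕜 := ℝ)).eventually_lt_const
    (half_pos hδ)
  filter_upwards [eventually_exists_represents (half_pos hδ), hsmall] with k ⟨s, hs, hsδ, hk⟩ h1
  have := csInf_le (hbdd k) ⟨hs, hk⟩
  linarith [hlt k]

/-- The vector `(b, a, 0, …, 0)`. -/
def planeVector (n : ℕ) (a b : ℝ) (i : Fin (n + 1)) : ℝ :=
  if i = 0 then b else if i = 1 then a else 0

lemma qForm_planeVector {n : ℕ} (hn : 1 ≤ n) (a b : ℝ) :
    qForm n (planeVector n a b) = a ^ 2 - √5 * b ^ 2 := by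
  have h10 : (1 : Fin (n + 1)) ≠ 0 := by
    obtain ⟨m, rfl⟩ := Nat.exists_eq_add_of_le' hn
    exact one_ne_zero
  have hsum : ∑ i ∈ Finset.Ioi (0 : Fin (n + 1)), planeVector n a b i ^ 2 = a ^ 2 := by
    rw [Finset.sum_eq_single_of_mem 1 (Finset.mem_Ioi.2 (Fin.pos_iff_ne_zero.2 h10))]
    · simp [planeVector, h10]
    · intro i hi hi1
      simp [planeVector, hi1, (Finset.mem_Ioi.1 hi).ne']
  rw [qForm, hsum]
  simp only [planeVector, if_true]
  ring

end GoldenForm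

open GoldenForm in
/-- For `n ≥ 4` there is a sequence of vectors `w_k ∈ ℝ^{n+1}` with all coordinates
in `𝒪_K = ℤ[(1+√5)/2] ⊆ ℝ`, such that `f(w_k) = (6+√5)^k` for all `k ≥ 1`,
eventually `(w_k)₁² > f(w_k) > 0`, and `(w_k)₁² / f(w_k) → 1`. -/
theorem exists_vectors_compact (n : ℕ) (hn : 4 ≤ n) :
    ∃ w : ℕ → (Fin (n + 1) → ℝ),
      (∀ k i, w k i ∈ Subring.closure {((1 + Real.sqrt 5) / 2 : ℝ)}) ∧
      (∀ k, 1 ≤ k → qForm n (w k) = ((6 : ℝ) + Real.sqrt 5) ^ k) ∧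
      (∀ᶠ k in atTop, 0 < qForm n (w k) ∧ qForm n (w k) < (w k 1) ^ 2) ∧
      Tendsto (fun k => (w k 1) ^ 2 / qForm n (w k)) atTop (nhds 1) := by
  obtain ⟨t, ht, hrep, hlim⟩ := exists_seq_represents
  choose a ha b hb hab hbb using hrep
  have h10 : (1 : Fin (n + 1)) ≠ 0 := by
    obtain ⟨m, rfl⟩ := Nat.exists_eq_add_of_le' (show 1 ≤ n by omega)
    exact one_ne_zero
  have hone (k : ℕ) : planeVector n (a k) (b k) 1 = a k := by simp [planeVector, h10]
  have hpos (k : ℕ) : 0 < (scale ^ k) ^ 2 := pow_pos (pow_pos scale_pos k) 2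
  have hq (k : ℕ) : qForm n (planeVector n (a k) (b k)) = (scale ^ k) ^ 2 := by
    rw [qForm_planeVector (by omega), ← root_sq, ← mul_pow, hbb, hab]
    linear_combination (scale ^ k) ^ 2 * Real.cosh_sq (t k)
  refine ⟨fun k => planeVector n (a k) (b k), fun k i => ?_, fun k _ => ?_,
    Eventually.of_forall fun k => ?_, ?_⟩
  · beta_reduce
    unfold planeVector
    split_ifs
    exacts [hb k, ha k, zero_mem _]
  · rw [hq, ← pow_mul, mul_comm, pow_mul, scale_sq, root_sq]
  · beta_reduce
    rw [hq, hone, hab, mul_pow]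
    exact ⟨hpos k, lt_mul_of_one_lt_right (hpos k)
      (one_lt_pow₀ (Real.one_lt_cosh.2 (ht k).ne') two_ne_zero)⟩
  · have hratio (k : ℕ) : planeVector n (a k) (b k) 1 ^ 2 /
        qForm n (planeVector n (a k) (b k)) = Real.cosh (t k) ^ 2 := by
      rw [hq, hone, hab, mul_pow, mul_div_cancel_left₀ _ (hpos k).ne']
    simp only [hratio]
    simpa using ((Real.continuous_cosh.tendsto 0).comp hlim).pow 2
end
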